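/- arXiv:2507.04744 — 10 statements merged into one kernel-verified Lean document; each statement's English description precedes it below -/
import Mathlib

section
/- Let (X,d) be a compact metric space and let f : X → X be a continuous ball expanding map. Then the chain recurrent set of f equals the closure of the set of periodic points of f, i.e. CR(f) = closure(Per(f)). -/
open Metric Set Function

/-- A finite sequence `c 0, c 1, ..., c k` (with `k ≥ 1`) is a `δ`-chain of `f` if
`dist (f (c i)) (c (i+1)) ≤ δ` for all `0 ≤ i ≤ k-1`. -/
def IsDeltaChain {X : Type*} [MetricSpace X] (f : X → X) (δ : ℝ) (c : ℕ → X) (k : ℕ) : Prop :=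
  1 ≤ k ∧ ∀ i < k, dist (f (c i)) (c (i + 1)) ≤ δ

/-- `x → y` : for every `δ > 0` there is a `δ`-chain of `f` from `x` to `y`. -/
def ChainReach {X : Type*} [MetricSpace X] (f : X → X) (x y : X) : Prop :=
  ∀ δ : ℝ, 0 < δ → ∃ (c : ℕ → X) (k : ℕ), IsDeltaChain f δ c k ∧ c 0 = x ∧ c k = y

/-- The chain recurrent set `CR(f) = {x | x → x}`. -/
def chainRecurrentSet {X : Type*} [MetricSpace X] (f : X → X) : Set X :=
  {x | ChainReach f x x}

/-- The set of chain components of `f`: equivalence classes of `↔` on `CR(f)`. -/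
def chainComponents {X : Type*} [MetricSpace X] (f : X → X) : Set (Set X) :=
  {C | ∃ x ∈ chainRecurrentSet f,
    C = {y ∈ chainRecurrentSet f | ChainReach f x y ∧ ChainReach f y x}}

/-- `f` is ball expanding with constants `L`, `δ₀`. -/
def BallExpandingWith {X : Type*} [MetricSpace X] (f : X → X) (L δ₀ : ℝ) : Prop :=
  ∀ (x : X) (δ : ℝ), 0 < δ → δ ≤ δ₀ → closedBall (f x) δ ⊆ f '' closedBall x (L * δ)

/-- `f` is ball expanding: there are `0 < L < 1` and `δ₀ > 0` with
`B_δ(f x) ⊆ f (B_{Lδ} x)` for all `x` and `0 < δ ≤ δ₀`. -/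
def BallExpanding {X : Type*} [MetricSpace X] (f : X → X) : Prop :=
  ∃ L δ₀ : ℝ, 0 < L ∧ L < 1 ∧ 0 < δ₀ ∧ BallExpandingWith f L δ₀

/-- A closed `f`-invariant set `S` is chain stable. -/
def ChainStable {X : Type*} [MetricSpace X] (f : X → X) (S : Set X) : Prop :=
  ∀ ε : ℝ, 0 < ε → ∃ δ : ℝ, 0 < δ ∧ ∀ (c : ℕ → X) (k : ℕ),
    IsDeltaChain f δ c k → c 0 ∈ S → infDist (c k) S ≤ ε

/-- `f` has the h-shadowing property. -/
def HShadowing {X : Type*} [MetricSpace X] (f : X → X) : Prop :=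
  ∀ ε : ℝ, 0 < ε → ∃ δ : ℝ, 0 < δ ∧ ∀ (c : ℕ → X) (k : ℕ), IsDeltaChain f δ c k →
    ∃ x : X, (∀ i < k, dist (f^[i] x) (c i) ≤ ε) ∧ f^[k] x = c k

/-- `f` has the `L`-Lipschitz shadowing property with constant `δ₀`. -/
def LipschitzShadowingWith {X : Type*} [MetricSpace X] (f : X → X) (L δ₀ : ℝ) : Prop :=
  ∀ δ : ℝ, 0 < δ → δ ≤ δ₀ → ∀ ξ : ℕ → X, (∀ i : ℕ, dist (f (ξ i)) (ξ (i + 1)) ≤ δ) →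
    ∃ x : X, ∀ i : ℕ, dist (f^[i] x) (ξ i) ≤ L * δ


/-- Preimages under the iterates of a ball expanding map can be chosen contractively. -/
lemma BallExpandingWith.exists_iterate_preimage {X : Type*} [MetricSpace X] {f : X → X}
    {L δ₀ : ℝ} (hL0 : 0 < L) (hL1 : L < 1) (h : BallExpandingWith f L δ₀) {k : ℕ} (hk : 1 ≤ k) :
    ∀ x y : X, dist y (f^[k] x) ≤ δ₀ →
      ∃ z, f^[k] z = y ∧ dist z x ≤ L * dist y (f^[k] x) := by
  have one_step : ∀ x y : X, dist y (f x) ≤ δ₀ → ∃ z, f z = y ∧ dist z x ≤ L * dist y (f x) := by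
    intro x y hxy
    rcases (dist_nonneg (x := y) (y := f x)).eq_or_lt with h0 | h0
    · exact ⟨x, (dist_eq_zero.1 h0.symm).symm, by simp [← h0]⟩
    · obtain ⟨z, hz, rfl⟩ := h x _ h0 hxy (mem_closedBall.2 le_rfl)
      exact ⟨z, rfl, hz⟩
  induction k, hk using Nat.le_induction with
  | base => exact one_step
  | succ k _ ih =>
    intro x y hxy
    rw [iterate_succ_apply] at hxy ⊢
    obtain ⟨z, hz, hzd⟩ := ih (f x) y hxy
    have hle : dist z (f x) ≤ dist y (f^[k] (f x)) :=
      hzd.trans (mul_le_of_le_one_left dist_nonneg hL1.le)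
    obtain ⟨w, hw, hwd⟩ := one_step x z (hle.trans hxy)
    exact ⟨w, by rw [iterate_succ_apply, hw, hz], hwd.trans (by gcongr)⟩

/-- A finite `δ`-chain of a ball expanding map is followed, up to its exact endpoint, by an orbit
starting `ε`-close to its initial point. -/
lemma BallExpandingWith.exists_iterate_eq_of_chain {X : Type*} [MetricSpace X] {f : X → X}
    {L δ₀ δ ε : ℝ} (h : BallExpandingWith f L δ₀) (hδ : 0 < δ) (hε : 0 < ε)
    (hδε : δ + ε ≤ δ₀) (hLε : L * (δ + ε) ≤ ε) (k : ℕ) :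
    ∀ c : ℕ → X, (∀ i < k, dist (f (c i)) (c (i + 1)) ≤ δ) →
      ∃ w, f^[k] w = c k ∧ dist w (c 0) ≤ ε := by
  induction k with
  | zero => exact fun c _ => ⟨c 0, rfl, by simpa using hε.le⟩
  | succ k ih =>
    intro c hc
    obtain ⟨w, hw, hwd⟩ := ih (fun i => c (i + 1)) fun i hi => hc (i + 1) (by omega)
    have hmem : w ∈ closedBall (f (c 0)) (δ + ε) := by
      have h0 := hc 0 (by omega)
      have := dist_triangle_right w (f (c 0)) (c 1)
      simp only [zero_add] at h0 hwd
      rw [mem_closedBall]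
      linarith
    obtain ⟨z, hz, rfl⟩ := h (c 0) (δ + ε) (by positivity) hδε hmem
    exact ⟨z, hw, (mem_closedBall.1 hz).trans hLε⟩

/-- A local fixed point theorem for continuous maps whose inverse is a set-valued contraction. -/
lemma exists_isFixedPt_of_contracting_preimage {X : Type*} [MetricSpace X] [CompleteSpace X]
    {g : X → X} (hg : Continuous g) {L δ₀ ε : ℝ} (hL0 : 0 < L) (hL1 : L < 1) (hε : 0 ≤ ε)
    (hεδ : ε ≤ δ₀)
    (h : ∀ x y : X, dist y (g x) ≤ δ₀ → ∃ z, g z = y ∧ dist z x ≤ L * dist y (g x))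
    {w : X} (hw : dist w (g w) ≤ ε) : ∃ p, IsFixedPt g p ∧ dist w p ≤ ε / (1 - L) := by
  choose! s hs hsd using fun x hx => h x x hx
  set u : ℕ → X := fun n => s^[n] w
  have hu : ∀ n, u (n + 1) = s (u n) := fun n => iterate_succ_apply' s n w
  have hle : ∀ n, ε * L ^ n ≤ δ₀ := fun n =>
    (mul_le_of_le_one_right hε (pow_le_one₀ hL0.le hL1.le)).trans hεδ
  have hdist : ∀ n, dist (u n) (g (u n)) ≤ ε * L ^ n := by
    intro n
    induction n with
    | zero => simpa [u] using hw
    | succ n ih =>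
      rw [hu, hs _ (ih.trans (hle n)), pow_succ]
      calc _ ≤ L * dist (u n) (g (u n)) := hsd _ (ih.trans (hle n))
        _ ≤ L * (ε * L ^ n) := by gcongr
        _ = _ := by ring
  have hgu : ∀ n, g (u (n + 1)) = u n := fun n => by rw [hu, hs _ ((hdist n).trans (hle n))]
  have hgeom : ∀ n, dist (u n) (u (n + 1)) ≤ ε * L ^ n := by
    intro n
    have h1 := hdist (n + 1)
    rw [hgu, dist_comm] at h1
    exact h1.trans (mul_le_mul_of_nonneg_left
      (pow_le_pow_of_le_one hL0.le hL1.le n.le_succ) hε)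
  obtain ⟨p, hp⟩ := cauchySeq_tendsto_of_complete (cauchySeq_of_le_geometric L ε hL1 hgeom)
  refine ⟨p, ?_, dist_le_of_le_geometric_of_tendsto₀ L ε hL1 hgeom hp⟩
  have h1 := (hg.tendsto p).comp (hp.comp (Filter.tendsto_add_atTop_nat 1))
  exact tendsto_nhds_unique (h1.congr hgu) hp

lemma closure_periodicPts_subset_chainRecurrentSet {X : Type*} [MetricSpace X] {f : X → X}
    (hf : Continuous f) : closure (periodicPts f) ⊆ chainRecurrentSet f := by
  intro x hx δ hδ
  obtain ⟨r, hr, hfr⟩ := Metric.continuous_iff.1 hf x (δ / 2) (half_pos hδ)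
  obtain ⟨p, ⟨n, hn, hpn⟩, hxp⟩ := Metric.mem_closure_iff.1 hx (min r (δ / 2)) (by positivity)
  have hpx : dist p x < r := by rw [dist_comm]; exact hxp.trans_le (min_le_left _ _)
  have hxp' : dist p x ≤ δ / 2 := by rw [dist_comm]; exact (hxp.trans_le (min_le_right _ _)).le
  refine ⟨fun i => if i = 0 ∨ i = n then x else f^[i] p, n, ⟨hn, fun i hi => ?_⟩,
    by simp, by simp⟩
  have h1 : dist (f (if i = 0 ∨ i = n then x else f^[i] p)) (f^[i + 1] p) ≤ δ / 2 := by
    split_ifs with h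
    · obtain rfl : i = 0 := by omega
      rw [dist_comm]
      exact (hfr p hpx).le
    · rw [iterate_succ_apply', dist_self]
      positivity
  have h2 : dist (f^[i + 1] p) (if i + 1 = 0 ∨ i + 1 = n then x else f^[i + 1] p) ≤ δ / 2 := by
    rcases eq_or_ne (i + 1) n with rfl | h
    · simpa only [or_true, if_true, hpn.eq] using hxp'
    · rw [if_neg (by simp [h]), dist_self]
      positivity
  exact (dist_triangle _ (f^[i + 1] p) _).trans (by linarith)

lemma chainRecurrentSet_subset_closure_periodicPts {X : Type*} [MetricSpace X] [CompleteSpace X]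
    {f : X → X} (hf : Continuous f) (hbe : BallExpanding f) :
    chainRecurrentSet f ⊆ closure (periodicPts f) := by
  obtain ⟨L, δ₀, hL0, hL1, hδ₀, h⟩ := hbe
  intro x hx
  have hL : 0 < 1 - L := by linarith
  refine Metric.mem_closure_iff.2 fun r hr => ?_
  obtain ⟨ε, hε, hεr, hεδ⟩ : ∃ ε, 0 < ε ∧ ε ≤ r * (1 - L) / 4 ∧ ε ≤ δ₀ / 2 :=
    ⟨min (r * (1 - L) / 4) (δ₀ / 2), by positivity, min_le_left _ _, min_le_right _ _⟩
  obtain ⟨c, k, ⟨hk, hc⟩, hc0, hck⟩ := hx ((1 - L) * ε) (by positivity)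
  obtain ⟨w, hw, hwx⟩ := h.exists_iterate_eq_of_chain (δ := (1 - L) * ε) (ε := ε)
    (by positivity) hε (by nlinarith) (by nlinarith [mul_nonneg (sq_nonneg (1 - L)) hε.le]) k c hc
  rw [hck] at hw
  rw [hc0] at hwx
  obtain ⟨p, hp, hwp⟩ := exists_isFixedPt_of_contracting_preimage (hf.iterate k) hL0 hL1 hε.le
    (by linarith) (h.exists_iterate_preimage hL0 hL1 hk) (w := w) (by rwa [hw])
  refine ⟨p, ⟨k, hk, hp⟩, ?_⟩
  have h1 : ε / (1 - L) ≤ r / 4 := by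
    rw [div_le_iff₀ hL]
    linarith
  have h2 : ε ≤ r / 4 := by nlinarith
  have h3 := dist_triangle_left x p w
  linarith

/-- For a continuous ball expanding map on a compact metric space,
the chain recurrent set equals the closure of the set of periodic points. -/
theorem chainRecurrentSet_eq_closure_periodicPts {X : Type*} [MetricSpace X] [CompactSpace X]
    (f : X → X) (hf : Continuous f) (hbe : BallExpanding f) :
    chainRecurrentSet f = closure (Function.periodicPts f) :=
  (chainRecurrentSet_subset_closure_periodicPts hf hbe).antisymm
    (closure_periodicPts_subset_chainRecurrentSet hf)
end

section
/- Let (X,d) be a compact metric space and let f : X → X be a continuous ball expanding map. Then f has only finitely many chain components, i.e. 𝒞(f) is a finite set. -/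
open Metric Set Function

theorem ChainReach.trans {X : Type*} [MetricSpace X] {f : X → X} {x y z : X}
    (hxy : ChainReach f x y) (hyz : ChainReach f y z) : ChainReach f x z := by
  intro δ hδ
  obtain ⟨c, k, ⟨hk, hc⟩, hc0, hck⟩ := hxy δ hδ
  obtain ⟨d, l, ⟨hl, hd⟩, hd0, hdl⟩ := hyz δ hδ
  refine ⟨fun i => if i < k then c i else d (i - k), k + l, ⟨by omega, fun i hi => ?_⟩, ?_, ?_⟩
  · rcases lt_trichotomy (i + 1) k with h | h | h
    · simpa [h, show i < k by omega] using hc i (by omega)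
    · have := hc i (by omega)
      rw [h, hck, ← hd0] at this
      simpa [h, show i < k by omega] using this
    · have := hd (i - k) (by omega)
      rw [show i - k + 1 = i + 1 - k by omega] at this
      simpa [show ¬ i + 1 < k by omega, show ¬ i < k by omega] using this
  · simpa [show 0 < k by omega] using hc0
  · simpa using hdl

/-- A point chain recurrent at scale `η` lies on an infinite periodic `η`-pseudo-orbit. -/
theorem exists_periodic_pseudoOrbit {X : Type*} [MetricSpace X] {f : X → X} {x : X}
    (hx : ChainReach f x x) {η : ℝ} (hη : 0 < η) :
    ∃ (c : ℕ → X) (k : ℕ), 1 ≤ k ∧ (∀ i, dist (f (c i)) (c (i + 1)) ≤ η) ∧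
      ∀ n, c (k * n) = x := by
  obtain ⟨c, k, ⟨hk, hc⟩, hc0, hck⟩ := hx η hη
  refine ⟨fun i => c (i % k), k, hk, fun i => ?_, fun n => by simpa using hc0⟩
  have hlt : i % k < k := Nat.mod_lt _ hk
  have h := hc (i % k) hlt
  have hmod : (i + 1) % k = (i % k + 1) % k := by simp
  rcases (Nat.succ_le_of_lt hlt).lt_or_eq with h' | h'
  · simpa only [hmod, Nat.mod_eq_of_lt h'] using h
  · have h'' : i % k + 1 = k := h'
    rw [h'', hck, ← hc0] at h
    simpa only [hmod, h'', Nat.mod_self] using h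

/-- Pulling a point back along a pseudo-orbit of a ball expanding map contracts its distance to
the pseudo-orbit, up to an error `a` controlled by the size of the jumps. -/
theorem BallExpandingWith.exists_pullback {X : Type*} [MetricSpace X] {f : X → X}
    {L δ₀ : ℝ} (hbe : BallExpandingWith f L δ₀) (hL : 0 < L) (hL1 : L < 1) {a ε : ℝ}
    (ha : 0 < a) (hε : 0 ≤ ε) (hsum : 2 * a + ε ≤ δ₀) {c : ℕ → X}
    (hc : ∀ i, dist (f (c i)) (c (i + 1)) ≤ a * (1 - L)) (n m : ℕ) {y : X}
    (hy : dist y (c (m + n)) ≤ ε) :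
    ∃ z, f^[n] z = y ∧ dist z (c m) ≤ a + L ^ n * ε := by
  induction n generalizing m with
  | zero => exact ⟨y, rfl, by simpa using hy.trans (by linarith)⟩
  | succ n ih =>
    obtain ⟨z', hz', hd⟩ := ih (m + 1) (by rwa [add_right_comm])
    have hpow : L ^ n * ε ≤ ε := mul_le_of_le_one_left hε (pow_le_one₀ hL.le hL1.le)
    have hpow0 : 0 ≤ L ^ n * ε := by positivity
    have hjump : a * (1 - L) ≤ a := by nlinarith
    have hjump0 : 0 < a * (1 - L) := mul_pos ha (by linarith)
    have hmem : z' ∈ closedBall (f (c m)) (a * (1 - L) + (a + L ^ n * ε)) := by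
      have := dist_triangle_right z' (f (c m)) (c (m + 1))
      have := hc m
      rw [mem_closedBall]
      linarith
    obtain ⟨z, hz, rfl⟩ := hbe (c m) _ (by linarith) (by linarith) hmem
    refine ⟨z, by rwa [iterate_succ_apply], (mem_closedBall.1 hz).trans ?_⟩
    rw [pow_succ]
    nlinarith [mul_nonneg ha.le (sq_nonneg (1 - L))]

/-- A chain recurrent point of a ball expanding map chain-reaches all nearby points. -/
theorem BallExpandingWith.chainReach_of_dist_le {X : Type*} [MetricSpace X] {f : X → X}
    (hf : UniformContinuous f) {L δ₀ : ℝ} (hbe : BallExpandingWith f L δ₀) (hL : 0 < L)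
    (hL1 : L < 1) (hδ₀ : 0 < δ₀) {x y : X} (hx : x ∈ chainRecurrentSet f)
    (hxy : dist y x ≤ δ₀ / 2) : ChainReach f x y := by
  intro δ hδ
  obtain ⟨ω, hω, huc⟩ := Metric.uniformContinuous_iff.1 hf δ hδ
  obtain ⟨a, ha, haδ, haω⟩ : ∃ a : ℝ, 0 < a ∧ a ≤ δ₀ / 4 ∧ a ≤ ω / 2 :=
    ⟨min (δ₀ / 4) (ω / 2), by positivity, min_le_left _ _, min_le_right _ _⟩
  obtain ⟨c, k, hk, hc, hcx⟩ :=
    exists_periodic_pseudoOrbit hx (mul_pos ha (show 0 < 1 - L by linarith))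
  obtain ⟨N, hN⟩ := exists_pow_lt_of_lt_one (show 0 < a / (δ₀ / 2) by positivity) hL1
  have hNk : N + 1 ≤ k * (N + 1) := Nat.le_mul_of_pos_left _ hk
  obtain ⟨z, hz, hzx⟩ := hbe.exists_pullback hL hL1 ha (half_pos hδ₀).le (by linarith) hc
    (k * (N + 1)) 0 (y := y) (by rwa [zero_add, hcx])
  have hsmall : L ^ (k * (N + 1)) * (δ₀ / 2) < a :=
    (lt_div_iff₀ (half_pos hδ₀)).1
      ((pow_le_pow_of_le_one hL.le hL1.le (by omega)).trans_lt hN)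
  rw [show c 0 = x by simpa using hcx 0] at hzx
  have hfz : dist (f x) (f z) ≤ δ := (huc (by rw [dist_comm]; linarith)).le
  refine ⟨fun i => if i = 0 then x else f^[i] z, k * (N + 1), ⟨by omega, fun i _ => ?_⟩,
    by simp, by simpa [show k ≠ 0 by omega] using hz⟩
  rcases Nat.eq_zero_or_pos i with rfl | hi
  · simpa using hfz
  · simpa [hi.ne', ← iterate_succ_apply' f] using hδ.le

/-- A continuous ball expanding map on a compact metric space has only finitely many
chain components. -/
theorem chainComponents_finite {X : Type*} [MetricSpace X] [CompactSpace X]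
    (f : X → X) (hf : Continuous f) (hbe : BallExpanding f) :
    (chainComponents f).Finite := by
  obtain ⟨L, δ₀, hL, hL1, hδ₀, hbe⟩ := hbe
  have huc := CompactSpace.uniformContinuous_of_continuous hf
  obtain ⟨T, -, hT, hcover⟩ :=
    finite_cover_balls_of_compact (isCompact_univ (X := X)) (show 0 < δ₀ / 4 by positivity)
  refine (hT.biUnion (t := fun p => {C | ∃ x ∈ chainRecurrentSet f, dist x p < δ₀ / 4 ∧
    C = {y ∈ chainRecurrentSet f | ChainReach f x y ∧ ChainReach f y x}})
    fun p _ => Set.Subsingleton.finite ?_).subset ?_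
  · rintro _ ⟨x, hx, hxp, rfl⟩ _ ⟨y, hy, hyp, rfl⟩
    have hd := dist_triangle_right x y p
    have hyx : ChainReach f y x := hbe.chainReach_of_dist_le huc hL hL1 hδ₀ hy (by linarith)
    have hxy : ChainReach f x y :=
      hbe.chainReach_of_dist_le huc hL hL1 hδ₀ hx (by rw [dist_comm]; linarith)
    ext w
    exact ⟨fun ⟨hw, h, h'⟩ => ⟨hw, hyx.trans h, h'.trans hxy⟩,
      fun ⟨hw, h, h'⟩ => ⟨hw, hxy.trans h, h'.trans hyx⟩⟩
  · rintro C ⟨x, hx, hC⟩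
    obtain ⟨p, hp, hxp⟩ := mem_iUnion₂.1 (hcover (mem_univ x))
    exact mem_iUnion₂.2 ⟨p, hp, x, hx, hxp, hC⟩
end

section
/- Let (X,d) be a connected compact metric space and let f : X → X be a continuous ball expanding map. Then f is locally eventually onto: for every nonempty open subset U of X there exists i ≥ 0 such that f^i(U) = X. -/
open Metric Set Function

/-- In a connected compact metric space, any two points are joined by chains of jumps at most `δ`
whose number of steps does not depend on the points. -/
theorem exists_uniform_chain_length {X : Type*} [MetricSpace X] [CompactSpace X]
    [ConnectedSpace X] {δ : ℝ} (hδ : 0 < δ) :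
    ∃ K : ℕ, ∀ x y : X, ∃ c : ℕ → X, c 0 = x ∧ c K = y ∧ ∀ i, dist (c i) (c (i + 1)) ≤ δ := by
  obtain ⟨p⟩ : Nonempty X := inferInstance
  let V : ℕ → Set X := fun k => Nat.rec {p} (fun _ S => thickening δ S) k
  have hV : ∀ k, V (k + 1) = thickening δ (V k) := fun _ => rfl
  have hmono : Monotone V := monotone_nat_of_le_succ fun k => by
    rw [hV]; exact self_subset_thickening hδ _
  have hchain : ∀ k, ∀ y ∈ V k,
      ∃ c : ℕ → X, c 0 = p ∧ c k = y ∧ ∀ i, dist (c i) (c (i + 1)) ≤ δ := by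
    intro k
    induction k with
    | zero =>
      intro y hy
      exact ⟨fun _ => p, rfl, (mem_singleton_iff.1 hy).symm, fun _ => by simpa using hδ.le⟩
    | succ k ih =>
      intro y hy
      rw [hV, mem_thickening_iff] at hy
      obtain ⟨z, hz, hyz⟩ := hy
      obtain ⟨c, h0, hk, hc⟩ := ih z hz
      refine ⟨fun i => if i ≤ k then c i else y, by simpa using h0, by simp, fun i => ?_⟩
      rcases lt_trichotomy i k with h | rfl | h
      · simpa [h.le, Nat.succ_le_of_lt h] using hc i
      · simpa [hk, dist_comm] using hyz.le
      · simpa [not_le.2 h, not_le.2 (h.trans (Nat.lt_succ_self i))] using hδ.le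
  have hopen : IsOpen (⋃ k, V (k + 1)) := isOpen_iUnion fun k => isOpen_thickening
  have hclosed : IsClosed (⋃ k, V (k + 1)) := by
    refine isClosed_of_closure_subset fun y hy => ?_
    obtain ⟨z, hz, hyz⟩ := Metric.mem_closure_iff.1 hy δ hδ
    obtain ⟨k, hk⟩ := mem_iUnion.1 hz
    exact mem_iUnion.2 ⟨k + 1, mem_thickening_iff.2 ⟨z, hk, hyz⟩⟩
  have huniv : (⋃ k, V (k + 1)) = univ :=
    IsClopen.eq_univ ⟨hclosed, hopen⟩ ⟨p, mem_iUnion.2 ⟨0, hmono zero_le_one (mem_singleton p)⟩⟩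
  obtain ⟨k, hk⟩ := isCompact_univ.elim_directed_cover (fun k => V (k + 1))
    (fun k => isOpen_thickening) huniv.ge
    (directed_of_isDirected_le fun a b h => hmono (Nat.succ_le_succ h))
  obtain ⟨K, hK⟩ : ∃ K, univ ⊆ V K := ⟨k + 1, hk⟩
  refine ⟨K + K, fun x y => ?_⟩
  obtain ⟨a, ha0, haK, ha⟩ := hchain K x (hK trivial)
  obtain ⟨b, hb0, hbK, hb⟩ := hchain K y (hK trivial)
  refine ⟨fun i => if i ≤ K then a (K - i) else b (i - K), by simpa using haK, ?_, fun i => ?_⟩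
  · by_cases h : K = 0
    · subst h
      simp [← hbK, ha0, hb0]
    · have : ¬ K + K ≤ K := by omega
      simpa [this] using hbK
  · rcases lt_trichotomy i K with h | rfl | h
    · obtain ⟨m, rfl⟩ := Nat.exists_eq_add_of_lt h
      have h1 : i + m + 1 - i = m + 1 := by omega
      have h2 : i + m + 1 - (i + 1) = m := by omega
      have h3 : i ≤ i + m + 1 := by omega
      have h4 : i + 1 ≤ i + m + 1 := by omega
      simpa only [h1, h2, h3, h4, if_true, dist_comm] using ha m
    · simpa [ha0, hb0] using hb 0
    · have h1 : ¬ i ≤ K := by omega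
      have h2 : ¬ i + 1 ≤ K := by omega
      have h3 : i + 1 - K = (i - K) + 1 := by omega
      simpa only [h1, h2, h3, if_false] using hb (i - K)

/-- Iterates of a ball expanding map are ball expanding. -/
theorem BallExpandingWith.iterate {X : Type*} [MetricSpace X] {f : X → X} {L δ₀ : ℝ}
    (hf : BallExpandingWith f L δ₀) (hL0 : 0 < L) (hL1 : L ≤ 1) (n : ℕ) :
    BallExpandingWith f^[n] (L ^ n) δ₀ := by
  induction n with
  | zero => intro x δ _ _; simp
  | succ n ih =>
    intro x δ hδ hδ₀ y hy
    rw [iterate_succ_apply] at hy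
    obtain ⟨z, hz, rfl⟩ := ih (f x) δ hδ hδ₀ hy
    have hle : L ^ n * δ ≤ δ₀ :=
      (mul_le_of_le_one_left hδ.le (pow_le_one₀ hL0.le hL1)).trans hδ₀
    obtain ⟨w, hw, rfl⟩ := hf x (L ^ n * δ) (by positivity) hle hz
    refine ⟨w, ?_, iterate_succ_apply f n w⟩
    rwa [pow_succ', mul_assoc]

/-- The endpoint of a `k`-step chain with jumps at most `δ` starting at `f x` has a preimage within
`k * (L * δ)` of `x`. -/
theorem BallExpandingWith.exists_lift_chain {X : Type*} [MetricSpace X] {f : X → X} {L δ₀ δ : ℝ}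
    (hf : BallExpandingWith f L δ₀) (hδ : 0 < δ) (hδ₀ : δ ≤ δ₀) {x : X} {c : ℕ → X}
    (h0 : c 0 = f x) (hc : ∀ i, dist (c i) (c (i + 1)) ≤ δ) (k : ℕ) :
    ∃ w, dist w x ≤ k * (L * δ) ∧ f w = c k := by
  induction k with
  | zero => exact ⟨x, by simp, h0.symm⟩
  | succ k ih =>
    obtain ⟨w, hw, hwk⟩ := ih
    have hmem : c (k + 1) ∈ closedBall (f w) δ := by
      rw [mem_closedBall, hwk, dist_comm]
      exact hc k
    obtain ⟨v, hv, hvk⟩ := hf w δ hδ hδ₀ hmem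
    refine ⟨v, ?_, hvk⟩
    have := dist_triangle v w x
    rw [mem_closedBall] at hv
    push_cast
    linarith

/-- If `X` is a connected compact metric space and `f` is a continuous ball expanding map,
then `f` is locally eventually onto. -/
theorem locallyEventuallyOnto_of_ballExpanding {X : Type*} [MetricSpace X] [CompactSpace X]
    [ConnectedSpace X] (f : X → X) (hf : Continuous f) (hbe : BallExpanding f) :
    ∀ U : Set X, IsOpen U → U.Nonempty → ∃ i : ℕ, f^[i] '' U = Set.univ := by
  obtain ⟨L, δ, hL0, hL1, hδ, hL⟩ := hbe
  rintro U hU ⟨x, hx⟩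
  obtain ⟨r, hr, hrU⟩ := Metric.isOpen_iff.1 hU x hx
  obtain ⟨K, hK⟩ := exists_uniform_chain_length (X := X) hδ
  have hlim : Filter.Tendsto (fun n : ℕ => (K : ℝ) * (L ^ n * δ)) Filter.atTop (nhds 0) := by
    simpa using ((tendsto_pow_atTop_nhds_zero_of_lt_one hL0.le hL1).mul_const δ).const_mul (K : ℝ)
  obtain ⟨n, hn⟩ := (hlim.eventually_lt_const hr).exists
  refine ⟨n, eq_univ_of_forall fun y => ?_⟩
  obtain ⟨c, h0, rfl, hc⟩ := hK (f^[n] x) y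
  obtain ⟨w, hw, hwK⟩ := (hL.iterate hL0 hL1.le n).exists_lift_chain hδ le_rfl h0 hc K
  exact ⟨w, hrU (mem_ball.2 (hw.trans_lt hn)), hwK⟩
end

section
/- Let (X,d) be a compact metric space and let f : X → X be a continuous ball expanding map. Then every terminal chain component C of f is a clopen (closed and open) subset of X. -/
open Metric Set Function

theorem IsDeltaChain.append {X : Type*} [MetricSpace X] {f : X → X} {δ : ℝ} {c d : ℕ → X}
    {k l : ℕ} (hc : IsDeltaChain f δ c k) (hd : IsDeltaChain f δ d l) (h : c k = d 0) :
    IsDeltaChain f δ (fun i => if i < k then c i else d (i - k)) (k + l) := by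
  refine ⟨hc.1.trans (Nat.le_add_right k l), fun i hi => ?_⟩
  dsimp only
  rcases lt_trichotomy (i + 1) k with h1 | h1 | h1
  · rw [if_pos (by omega), if_pos h1]
    exact hc.2 i (by omega)
  · have hstep := hc.2 i (by omega)
    rw [h1, h] at hstep
    rwa [if_pos (by omega), if_neg (by omega), h1, Nat.sub_self]
  · have hstep := hd.2 (i - k) (by omega)
    rwa [if_neg (by omega), if_neg (by omega), show i + 1 - k = i - k + 1 by omega]

/-- A chain recurrent point lies on arbitrarily long `δ`-loops. -/
theorem ChainReach.exists_long_loop {X : Type*} [MetricSpace X] {f : X → X} {x : X}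
    (hx : ChainReach f x x) {δ : ℝ} (hδ : 0 < δ) (n : ℕ) :
    ∃ (c : ℕ → X) (k : ℕ), n ≤ k ∧ IsDeltaChain f δ c k ∧ c 0 = x ∧ c k = x := by
  obtain ⟨d, l, hd, hd0, hdl⟩ := hx δ hδ
  induction n with
  | zero => exact ⟨d, l, Nat.zero_le l, hd, hd0, hdl⟩
  | succ n ih =>
    obtain ⟨c, k, hnk, hc, hc0, hck⟩ := ih
    refine ⟨_, k + l, ?_, hc.append hd (hck.trans hd0.symm), ?_, ?_⟩
    · have := hd.1
      omega
    · exact (if_pos hc.1).trans hc0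
    · simpa using hdl

/-- The relation `x → ·` has closed fibres. -/
theorem isClosed_setOf_chainReach_right {X : Type*} [MetricSpace X] (f : X → X) (x : X) :
    IsClosed {y | ChainReach f x y} := by
  refine isClosed_of_closure_subset fun y hy δ hδ => ?_
  obtain ⟨z, hz, hyz⟩ := Metric.mem_closure_iff.1 hy (δ / 2) (half_pos hδ)
  obtain ⟨c, k, hc, hc0, hck⟩ := hz (δ / 2) (half_pos hδ)
  have hk := hc.1
  refine ⟨Function.update c k y, k, ⟨hk, fun i hi => ?_⟩, ?_, Function.update_self ..⟩
  · have hstep := hc.2 i hi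
    rw [Function.update_of_ne hi.ne]
    by_cases h : i + 1 = k
    · rw [h, Function.update_self]
      rw [h, hck] at hstep
      have := dist_triangle (f (c i)) z y
      rw [dist_comm z y] at this
      linarith
    · rw [Function.update_of_ne h]
      linarith
  · rwa [Function.update_of_ne (by omega)]

/-- For continuous `f`, the relation `· → y` has closed fibres. -/
theorem isClosed_setOf_chainReach_left {X : Type*} [MetricSpace X] {f : X → X}
    (hf : Continuous f) (y : X) : IsClosed {x | ChainReach f x y} := by
  refine isClosed_of_closure_subset fun x hx δ hδ => ?_
  obtain ⟨ρ, hρ, hfρ⟩ := Metric.continuous_iff.1 hf x (δ / 2) (half_pos hδ)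
  obtain ⟨z, hz, hxz⟩ := Metric.mem_closure_iff.1 hx ρ hρ
  obtain ⟨c, k, hc, hc0, hck⟩ := hz (δ / 2) (half_pos hδ)
  have hk := hc.1
  refine ⟨Function.update c 0 x, k, ⟨hk, fun i hi => ?_⟩, Function.update_self .., ?_⟩
  · have hstep := hc.2 i hi
    rw [Function.update_of_ne (Nat.succ_ne_zero i)]
    rcases Nat.eq_zero_or_pos i with rfl | h
    · rw [Function.update_self]
      rw [hc0] at hstep
      have h1 := hfρ z (by rwa [dist_comm])
      have := dist_triangle (f x) (f z) (c (0 + 1))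
      rw [dist_comm (f x) (f z)] at this
      linarith
    · rw [Function.update_of_ne h.ne']
      linarith
  · rwa [Function.update_of_ne (by omega)]

/-- A point near the end of a `δ`-chain pulls back along the chain to a point near its start:
the initial error `s` is contracted by `L` at each step, and `b` absorbs the errors of the chain. -/
theorem BallExpandingWith.exists_preimage_near {X : Type*} [MetricSpace X] {f : X → X}
    {L δ₀ δ b : ℝ} (hbe : BallExpandingWith f L δ₀) (hL : 0 < L) (hL1 : L < 1) (hδ : 0 < δ)
    (hb : 0 ≤ b) (hbδ : L * (b + δ) ≤ b) {c : ℕ → X} {k : ℕ}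
    (hc : ∀ i < k, dist (f (c i)) (c (i + 1)) ≤ δ) {s : ℝ} (hs : 0 ≤ s) (hsδ : s + b + δ ≤ δ₀)
    {y : X} (hy : dist y (c k) ≤ s + b) :
    ∃ z, f^[k] z = y ∧ dist z (c 0) ≤ L ^ k * s + b := by
  induction k generalizing s y with
  | zero => exact ⟨y, rfl, by simpa using hy⟩
  | succ k ih =>
    have hyk : y ∈ closedBall (f (c k)) (s + b + δ) := by
      have := dist_triangle y (c (k + 1)) (f (c k))
      have hstep := hc k k.lt_succ_self
      rw [dist_comm] at hstep
      exact mem_closedBall.2 (by linarith)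
    obtain ⟨w, hw, rfl⟩ := hbe (c k) (s + b + δ) (by linarith) hsδ hyk
    have hLs : L * s ≤ s := mul_le_of_le_one_left hs hL1.le
    obtain ⟨z, rfl, hz⟩ := ih (fun i hi => hc i (hi.trans k.lt_succ_self)) (s := L * s)
      (by positivity) (by linarith) (y := w) (by rw [mem_closedBall] at hw; linarith)
    exact ⟨z, iterate_succ_apply' f k z, by rwa [pow_succ, mul_assoc]⟩

/-- A chain recurrent point of a continuous ball expanding map chain-reaches a whole ball
around itself. -/
theorem ChainReach.of_dist_le_half {X : Type*} [MetricSpace X] {f : X → X} (hf : Continuous f)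
    {L δ₀ : ℝ} (hbe : BallExpandingWith f L δ₀) (hL : 0 < L) (hL1 : L < 1) (hδ₀ : 0 < δ₀)
    {x y : X} (hx : ChainReach f x x) (hxy : dist y x ≤ δ₀ / 2) : ChainReach f x y := by
  intro ε hε
  obtain ⟨ρ, hρ, hfρ⟩ := Metric.continuous_iff.1 hf x ε hε
  obtain ⟨b, hb, hbm⟩ := exists_between (lt_min (half_pos hρ) (by positivity : 0 < δ₀ / 4))
  have hbρ := hbm.trans_le (min_le_left _ _)
  have hbδ₀ := hbm.trans_le (min_le_right _ _)
  have hδ : 0 < b * (1 - L) := mul_pos hb (by linarith)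
  obtain ⟨n, hn⟩ := exists_pow_lt_of_lt_one (by positivity : 0 < ρ / δ₀) hL1
  obtain ⟨c, k, hnk, hc, hc0, hck⟩ := hx.exists_long_loop hδ n
  obtain ⟨z, hzy, hz⟩ := hbe.exists_preimage_near hL hL1 hδ hb.le
    (by nlinarith [mul_nonneg hb.le (sq_nonneg (1 - L))]) hc.2 (half_pos hδ₀).le
    (by nlinarith [mul_pos hb hL]) (y := y) (by rw [hck]; linarith)
  have hzx : dist z x < ρ := by
    have hLk : L ^ k < ρ / δ₀ := (pow_le_pow_of_le_one hL.le hL1.le hnk).trans_lt hn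
    rw [lt_div_iff₀ hδ₀] at hLk
    rw [hc0] at hz
    linarith
  have hk := hc.1
  refine ⟨Function.update (fun i => f^[i] z) 0 x, k, ⟨hk, fun i _ => ?_⟩,
    Function.update_self .., ?_⟩
  · rw [Function.update_of_ne (Nat.succ_ne_zero i), iterate_succ_apply']
    rcases Nat.eq_zero_or_pos i with rfl | h
    · rw [Function.update_self, dist_comm]
      exact (hfρ z hzx).le
    · rw [Function.update_of_ne h.ne', dist_self]
      exact hε.le
  · rwa [Function.update_of_ne (by omega)]

/-- A closed chain stable set contains every point chain-reachable from it. -/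
theorem ChainStable.mem_of_chainReach {X : Type*} [MetricSpace X] {f : X → X} {S : Set X}
    (hS : ChainStable f S) (hcl : IsClosed S) {x y : X} (hx : x ∈ S) (hxy : ChainReach f x y) :
    y ∈ S := by
  rw [hcl.mem_iff_infDist_zero ⟨x, hx⟩]
  refine le_antisymm (le_of_forall_pos_le_add fun ε hε => ?_) infDist_nonneg
  obtain ⟨δ, hδ, h⟩ := hS ε hε
  obtain ⟨c, k, hc, rfl, rfl⟩ := hxy δ hδ
  simpa using h c k hc hx

/-- Chain components of a continuous map are closed. -/
theorem isClosed_of_mem_chainComponents {X : Type*} [MetricSpace X] {f : X → X}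
    (hf : Continuous f) {C : Set X} (hC : C ∈ chainComponents f) : IsClosed C := by
  obtain ⟨x, -, rfl⟩ := hC
  convert (isClosed_setOf_chainReach_right f x).inter (isClosed_setOf_chainReach_left hf x)
    using 1
  ext y
  exact ⟨fun h => h.2, fun h => ⟨h.2.trans h.1, h⟩⟩

/-- For a continuous ball expanding map on a compact metric space, every terminal
(i.e. chain stable) chain component is clopen in `X`. -/
theorem terminal_chainComponent_isClopen {X : Type*} [MetricSpace X] [CompactSpace X]
    (f : X → X) (hf : Continuous f) (hbe : BallExpanding f)
    {C : Set X} (hC : C ∈ chainComponents f) (hter : ChainStable f C) :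
    IsClopen C := by
  obtain ⟨L, δ₀, hL, hL1, hδ₀, hbe⟩ := hbe
  have hcl := isClosed_of_mem_chainComponents hf hC
  refine ⟨hcl, Metric.isOpen_iff.2 fun x hx => ⟨δ₀ / 2, half_pos hδ₀, fun y hy => ?_⟩⟩
  have hxx : ChainReach f x x := by
    obtain ⟨x₀, -, rfl⟩ := hC
    exact hx.1
  exact hter.mem_of_chainReach hcl hx
    (ChainReach.of_dist_le_half hf hbe hL hL1 hδ₀ hxx (mem_ball.1 hy).le)
end

section
/- Let (X,d) be a compact metric space and let f : X → X be a continuous ball expanding map. Then every point of X is eventually mapped into the chain recurrent set: X = ⋃_{i≥0} f^{-i}(CR(f)), i.e. for every x ∈ X there exists i ≥ 0 with f^i(x) ∈ CR(f). -/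
open Metric Set Function

/-- A `δ`-chain can be extended by one step. -/
lemma exists_isDeltaChain_snoc {X : Type*} [MetricSpace X] {f : X → X} {δ : ℝ} {x z w : X}
    (h : ∃ (c : ℕ → X) (k : ℕ), IsDeltaChain f δ c k ∧ c 0 = x ∧ c k = z)
    (hw : dist (f z) w ≤ δ) :
    ∃ (c : ℕ → X) (k : ℕ), IsDeltaChain f δ c k ∧ c 0 = x ∧ c k = w := by
  obtain ⟨c, k, ⟨hk, hc⟩, h0, hz⟩ := h
  refine ⟨fun i => if i ≤ k then c i else w, k + 1, ⟨by omega, fun i hi => ?_⟩, by simp [h0],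
    by simp⟩
  rcases Nat.lt_succ_iff_lt_or_eq.mp hi with hik | rfl
  · simpa [hik.le, Nat.succ_le_of_lt hik] using hc i hik
  · simpa [hz] using hw

/-- A `δ`-chain can be extended along the orbit of its endpoint. -/
lemma exists_isDeltaChain_iterate {X : Type*} [MetricSpace X] {f : X → X} {δ : ℝ} (hδ : 0 ≤ δ)
    {x z : X} (h : ∃ (c : ℕ → X) (k : ℕ), IsDeltaChain f δ c k ∧ c 0 = x ∧ c k = z) (n : ℕ) :
    ∃ (c : ℕ → X) (k : ℕ), IsDeltaChain f δ c k ∧ c 0 = x ∧ c k = f^[n] z := by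
  induction n with
  | zero => exact h
  | succ n ih =>
    refine exists_isDeltaChain_snoc ih ?_
    rwa [iterate_succ_apply', dist_self]

/-- Every point of an `ω`-limit set has a preimage in that `ω`-limit set. -/
lemma exists_mapClusterPt_iterate_preimage {X : Type*} [MetricSpace X] [CompactSpace X]
    {f : X → X} (hf : Continuous f) {x p : X}
    (hp : MapClusterPt p Filter.atTop fun n => f^[n] x) :
    ∃ q, f q = p ∧ MapClusterPt q Filter.atTop fun n => f^[n] x := by
  obtain ⟨φ, hφ, hlim⟩ := hp.tendsto_subseq
  obtain ⟨q, ψ, hψ, hq⟩ := CompactSpace.tendsto_subseq fun n => f^[φ (n + 1) - 1] x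
  have hsub : StrictMono fun n => φ (ψ n + 1) := fun a b hab =>
    hφ (Nat.succ_lt_succ (hψ hab))
  have hpos : ∀ n, 0 < φ (ψ n + 1) := fun n => (Nat.succ_pos _).trans_le (hφ.id_le _)
  refine ⟨q, tendsto_nhds_unique ((hf.tendsto q).comp hq) ?_, ?_⟩
  · have := hlim.comp ((Filter.tendsto_add_atTop_nat 1).comp hψ.tendsto_atTop)
    refine this.congr fun n => ?_
    simp only [comp_apply]
    rw [← iterate_succ_apply' f, Nat.succ_eq_add_one, Nat.sub_add_cancel (hpos n)]
  · exact MapClusterPt.of_comp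
      ((Filter.tendsto_sub_atTop_nat 1).comp hsub.tendsto_atTop) hq.mapClusterPt

/-- For a ball expanding map, a point close to an `ω`-limit set has preimages under the iterates
of the map that approach the `ω`-limit set geometrically. -/
lemma BallExpandingWith.exists_iterate_eq_dist_le {X : Type*} [MetricSpace X] [CompactSpace X]
    {f : X → X} {L δ₀ : ℝ} (hbe : BallExpandingWith f L δ₀) (hf : Continuous f)
    (hL0 : 0 < L) (hL1 : L < 1) (hδ₀ : 0 < δ₀) {x y p : X}
    (hp : MapClusterPt p Filter.atTop fun n => f^[n] x) (hy : dist y p ≤ δ₀) (n : ℕ) :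
    ∃ z q, f^[n] z = y ∧ dist z q ≤ L ^ n * δ₀ ∧
      MapClusterPt q Filter.atTop fun n => f^[n] x := by
  induction n with
  | zero => exact ⟨y, p, rfl, by simpa using hy, hp⟩
  | succ n ih =>
    obtain ⟨z, q, hz, hzq, hq⟩ := ih
    obtain ⟨r, rfl, hr⟩ := exists_mapClusterPt_iterate_preimage hf hq
    obtain ⟨u, hu, rfl⟩ := hbe r (L ^ n * δ₀) (by positivity)
      (mul_le_of_le_one_left hδ₀.le (pow_le_one₀ hL0.le hL1.le)) (mem_closedBall.mpr hzq)
    exact ⟨u, r, hz, by rw [pow_succ', mul_assoc]; exact mem_closedBall.mp hu, hr⟩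

/-- For a continuous ball expanding map on a compact metric space, every point is eventually
mapped into the chain recurrent set. -/
theorem eventually_mem_chainRecurrentSet {X : Type*} [MetricSpace X] [CompactSpace X]
    (f : X → X) (hf : Continuous f) (hbe : BallExpanding f) (x : X) :
    ∃ i : ℕ, f^[i] x ∈ chainRecurrentSet f := by
  obtain ⟨L, δ₀, hL0, hL1, hδ₀, hbe⟩ := hbe
  obtain ⟨p, hp⟩ : ∃ p, MapClusterPt p Filter.atTop fun n => f^[n] x :=
    exists_clusterPt_of_compactSpace _
  obtain ⟨i, hi⟩ := (hp.frequently (closedBall_mem_nhds p hδ₀)).exists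
  refine ⟨i, fun ε hε => ?_⟩
  obtain ⟨n, hn⟩ := exists_pow_lt_of_lt_one (div_pos hε hδ₀) hL1
  rw [lt_div_iff₀ hδ₀] at hn
  obtain ⟨z, q, hz, hzq, hq⟩ :=
    hbe.exists_iterate_eq_dist_le hf hL0 hL1 hδ₀ hp (mem_closedBall.mp hi) n
  obtain ⟨r, rfl, hr⟩ := exists_mapClusterPt_iterate_preimage hf hq
  obtain ⟨m, hmr, hm⟩ := ((hr.frequently (closedBall_mem_nhds r hε)).and_eventually
    (Filter.eventually_ge_atTop (i + 2))).exists
  obtain ⟨j, rfl⟩ := Nat.exists_eq_add_of_le' hm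
  have orbit := exists_isDeltaChain_iterate (f := f) hε.le (x := f^[i] x) (z := f (f^[i] x))
    ⟨fun k => f^[k] (f^[i] x), 1, ⟨le_rfl, fun k _ => by
      simpa only [iterate_succ_apply', dist_self] using hε.le⟩, rfl, rfl⟩ j
  have toLimit := exists_isDeltaChain_snoc (w := r) orbit (by
    rw [← iterate_succ_apply' f, ← iterate_succ_apply f, ← iterate_add_apply,
      show (j + 1).succ + i = j + (i + 2) by omega]
    exact mem_closedBall.mp hmr)
  have toPreimage := exists_isDeltaChain_snoc (w := z) toLimit (by
    rw [dist_comm]; exact hzq.trans hn.le)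
  simpa only [hz] using exists_isDeltaChain_iterate hε.le toPreimage n
end

section
/- Let (X,d) be a connected compact metric space and let f : X → X be a continuous map with the h-shadowing property. Then f is locally eventually onto: for every nonempty open subset U of X there exists i ≥ 0 such that f^i(U) = X. -/
open Metric Set Function

/-- The set of points within `δ` of the image `f '' s`. -/
def fatImage {X : Type*} [MetricSpace X] (f : X → X) (δ : ℝ) (s : Set X) : Set X :=
  thickening δ (f '' s)

section FatImage

variable {X : Type*} [MetricSpace X] {f : X → X} {δ : ℝ}

theorem mem_fatImage {s : Set X} {y : X} :
    y ∈ fatImage f δ s ↔ ∃ p ∈ s, dist (f p) y < δ := by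
  simp [fatImage, mem_thickening_iff, dist_comm]

theorem isOpen_fatImage (s : Set X) : IsOpen (fatImage f δ s) :=
  isOpen_thickening

theorem fatImage_mono : Monotone (fatImage f δ) := fun _ _ h =>
  thickening_subset_of_subset δ (image_mono h)

theorem isOpen_iterate_fatImage {n : ℕ} (hn : 1 ≤ n) (s : Set X) :
    IsOpen ((fatImage f δ)^[n] s) := by
  obtain ⟨m, rfl⟩ := Nat.exists_eq_add_of_le' hn
  rw [iterate_succ_apply']
  exact isOpen_fatImage _

theorem fatImage_iUnion {ι : Type*} (s : ι → Set X) :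
    fatImage f δ (⋃ i, s i) = ⋃ i, fatImage f δ (s i) := by
  ext y
  simp only [mem_fatImage, mem_iUnion]
  grind

theorem iterate_fatImage_iUnion {ι : Type*} (n : ℕ) (s : ι → Set X) :
    (fatImage f δ)^[n] (⋃ i, s i) = ⋃ i, (fatImage f δ)^[n] (s i) := by
  induction n with
  | zero => rfl
  | succ n ih => simp only [iterate_succ_apply', ih, fatImage_iUnion]

theorem image_closure_subset_fatImage (hf : Continuous f) (hδ : 0 < δ) (s : Set X) :
    f '' closure s ⊆ fatImage f δ s :=
  (image_closure_subset_closure_image hf).trans (closure_subset_thickening hδ _)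

theorem iterate_image_closure_subset (hf : Continuous f) (hδ : 0 < δ) {n : ℕ} (hn : 1 ≤ n)
    (s : Set X) : f^[n] '' closure s ⊆ (fatImage f δ)^[n] s := by
  induction n, hn using Nat.le_induction with
  | base => exact image_closure_subset_fatImage hf hδ s
  | succ n _ ih =>
    rw [iterate_succ', image_comp, iterate_succ_apply']
    exact (image_mono (ih.trans subset_closure)).trans (image_closure_subset_fatImage hf hδ _)

theorem exists_chain_of_mem_iterate_fatImage {x : X} {n : ℕ} {y : X}
    (hy : y ∈ (fatImage f δ)^[n] {x}) :
    ∃ c : ℕ → X, c 0 = x ∧ c n = y ∧ ∀ i < n, dist (f (c i)) (c (i + 1)) ≤ δ := by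
  induction n generalizing y with
  | zero => exact ⟨fun _ => x, rfl, (mem_singleton_iff.1 hy).symm, by simp⟩
  | succ n ih =>
    rw [iterate_succ_apply', mem_fatImage] at hy
    obtain ⟨p, hp, hpy⟩ := hy
    obtain ⟨c, h0, hcn, hc⟩ := ih hp
    refine ⟨fun i => if i ≤ n then c i else y, by simpa using h0, by simp, fun i hi => ?_⟩
    rcases Nat.lt_succ_iff_lt_or_eq.1 hi with h | rfl
    · simpa [h.le, Nat.succ_le_iff.2 h] using hc i h
    · simpa [hcn] using hpy.le

end FatImage

/-- Orbits of a map with h-shadowing can be perturbed at the endpoint, uniformly in their length. -/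
theorem HShadowing.exists_iterate_eq {X : Type*} [MetricSpace X] {f : X → X}
    (hsh : HShadowing f) {ε : ℝ} (hε : 0 < ε) :
    ∃ δ : ℝ, 0 < δ ∧ ∀ (p y : X) (k : ℕ), 1 ≤ k → dist (f^[k] p) y ≤ δ →
      ∃ z, dist z p ≤ ε ∧ f^[k] z = y := by
  obtain ⟨δ, hδ, H⟩ := hsh ε hε
  refine ⟨δ, hδ, fun p y k hk hy => ?_⟩
  have hc : IsDeltaChain f δ (fun i => if i < k then f^[i] p else y) k := by
    refine ⟨hk, fun i hi => ?_⟩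
    simp only [hi, if_true, ← iterate_succ_apply' f]
    split_ifs with h
    · simpa using hδ.le
    · obtain rfl : k = i + 1 := by omega
      exact hy
  obtain ⟨z, hz, hzk⟩ := H _ k hc
  exact ⟨z, by simpa [show 0 < k from hk] using hz 0 hk, by simpa using hzk⟩

/-- A map with h-shadowing on a connected compact space has no proper nonempty trapping region. -/
theorem HShadowing.eq_univ_of_trapping {X : Type*} [MetricSpace X] [CompactSpace X]
    [ConnectedSpace X] {f : X → X} (hf : Continuous f) (hsh : HShadowing f) {n : ℕ} (hn : 1 ≤ n)
    {V : Set X} (hV : IsOpen V) (hne : V.Nonempty) (htrap : f^[n] '' closure V ⊆ V) :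
    V = univ := by
  let D : ℕ → Set X := fun j => f^[n * j] '' closure V
  have hD : ∀ j, D (j + 1) ⊆ D j := fun j => by
    simp only [D, Nat.mul_succ, iterate_add, image_comp]
    exact image_mono (htrap.trans subset_closure)
  have hcpt : ∀ j, IsCompact (D j) := fun j => isClosed_closure.isCompact.image (hf.iterate _)
  have hA_ne : (⋂ j, D j).Nonempty :=
    IsCompact.nonempty_iInter_of_sequence_nonempty_isCompact_isClosed D hD
      (fun j => (hne.mono subset_closure).image _) (hcpt 0) fun j => (hcpt j).isClosed
  have hA_closed : IsClosed (⋂ j, D j) := isClosed_iInter fun j => (hcpt j).isClosed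
  obtain ⟨ε, hε, hεV⟩ :=
    (isClosed_closure.isCompact.image (hf.iterate n)).exists_cthickening_subset_open hV htrap
  obtain ⟨δ, hδ, H⟩ := hsh.exists_iterate_eq hε
  have hA_open : IsOpen (⋂ j, D j) := by
    refine Metric.isOpen_iff.2 fun y hy => ⟨δ, hδ, fun y' hy' => mem_iInter.2 fun j => hD j ?_⟩
    obtain ⟨x, hx, rfl⟩ := mem_iInter.1 hy (j + 1 + 1)
    have hk : 1 ≤ n * (j + 1) := Nat.mul_pos hn j.succ_pos
    rw [Nat.mul_succ n (j + 1), iterate_add_apply] at hy'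
    obtain ⟨z, hz, hzy⟩ := H (f^[n] x) y' (n * (j + 1)) hk (mem_ball'.1 hy').le
    exact ⟨z, subset_closure (hεV (mem_cthickening_of_dist_le z _ ε _ ⟨x, hx, rfl⟩ hz)), hzy⟩
  have hA := IsClopen.eq_univ ⟨hA_closed, hA_open⟩ hA_ne
  refine eq_univ_of_univ_subset ?_
  rw [← hA]
  refine (iInter_subset D 1).trans ?_
  simpa only [D, mul_one] using htrap

theorem HShadowing.iUnion_iterate_fatImage_eq_univ {X : Type*} [MetricSpace X] [CompactSpace X]
    [ConnectedSpace X] {f : X → X} (hf : Continuous f) (hsh : HShadowing f) {δ : ℝ} (hδ : 0 < δ)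
    {n : ℕ} (hn : 1 ≤ n) (x : X) : ⋃ j, (fatImage f δ)^[n * (j + 1)] {x} = univ := by
  refine hsh.eq_univ_of_trapping hf hn
    (isOpen_iUnion fun j => isOpen_iterate_fatImage (Nat.mul_pos hn j.succ_pos) _) ?_ ?_
  · refine ⟨f^[n] x, mem_iUnion.2 ⟨0, ?_⟩⟩
    rw [zero_add, mul_one]
    exact iterate_image_closure_subset hf hδ hn _ (mem_image_of_mem _ (subset_closure rfl))
  · refine (iterate_image_closure_subset hf hδ hn _).trans ?_
    rw [iterate_fatImage_iUnion]
    refine iUnion_subset fun j => ?_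
    rw [← iterate_add_apply, add_comm, ← Nat.mul_succ]
    exact subset_iUnion (fun j => (fatImage f δ)^[n * (j + 1)] {x}) (j + 1)

theorem HShadowing.exists_iterate_fatImage_eq_univ {X : Type*} [MetricSpace X] [CompactSpace X]
    [ConnectedSpace X] {f : X → X} (hf : Continuous f) (hsh : HShadowing f) {δ : ℝ} (hδ : 0 < δ)
    (x : X) : ∃ N, 1 ≤ N ∧ (fatImage f δ)^[N] {x} = univ := by
  obtain ⟨m, hm⟩ := mem_iUnion.1
    ((hsh.iUnion_iterate_fatImage_eq_univ hf hδ le_rfl x).symm ▸ mem_univ x)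
  rw [one_mul] at hm
  have hmono : Monotone fun j => (fatImage f δ)^[(m + 1) * (j + 1)] {x} := by
    refine monotone_nat_of_le_succ fun j => ?_
    rw [Nat.mul_succ (m + 1) (j + 1), iterate_add_apply]
    exact fatImage_mono.iterate _ (singleton_subset_iff.2 hm)
  have hpos : ∀ j, 1 ≤ (m + 1) * (j + 1) := fun j => Nat.mul_pos m.succ_pos j.succ_pos
  obtain ⟨j, hj⟩ := isCompact_univ.elim_directed_cover _
    (fun j => isOpen_iterate_fatImage (hpos j) {x})
    (hsh.iUnion_iterate_fatImage_eq_univ hf hδ m.succ_pos x).ge hmono.directed_le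
  exact ⟨_, hpos j, eq_univ_of_univ_subset hj⟩

/-- Theorem B.1: if `X` is a connected compact metric space and `f` is a continuous map with
the h-shadowing property, then `f` is locally eventually onto. -/
theorem locallyEventuallyOnto_of_hShadowing {X : Type*} [MetricSpace X] [CompactSpace X]
    [ConnectedSpace X] (f : X → X) (hf : Continuous f) (hsh : HShadowing f) :
    ∀ U : Set X, IsOpen U → U.Nonempty → ∃ i : ℕ, f^[i] '' U = Set.univ := by
  rintro U hU ⟨x, hx⟩
  obtain ⟨ε, hε, hball⟩ := Metric.nhds_basis_closedBall.mem_iff.1 (hU.mem_nhds hx)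
  obtain ⟨δ, hδ, H⟩ := hsh ε hε
  obtain ⟨N, hN, huniv⟩ := hsh.exists_iterate_fatImage_eq_univ hf hδ x
  refine ⟨N, eq_univ_of_forall fun y => ?_⟩
  obtain ⟨c, h0, rfl, hc⟩ := exists_chain_of_mem_iterate_fatImage (huniv.symm ▸ mem_univ y)
  obtain ⟨z, hz, hzN⟩ := H c N ⟨hN, hc⟩
  exact ⟨z, hball (by simpa [h0] using hz 0 hN), hzN⟩
end

section
/- Let (X,d) be a compact metric space, f : X → X a continuous map, and S a closed subset of X with f(S) = S which is chain stable. Then for every r > 0 there exists a subset A of X such that S ⊆ A ⊆ B_r(S) and f(closure(A)) ⊆ interior(A). -/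
open Metric Set Function

/-- The set of endpoints of `δ`-chains of `f` starting in `S`. -/
def chainImage {X : Type*} [MetricSpace X] (f : X → X) (δ : ℝ) (S : Set X) : Set X :=
  {y | ∃ (c : ℕ → X) (k : ℕ), IsDeltaChain f δ c k ∧ c 0 ∈ S ∧ c k = y}

lemma image_subset_chainImage {X : Type*} [MetricSpace X] (f : X → X) {δ : ℝ} (hδ : 0 ≤ δ)
    (S : Set X) : f '' S ⊆ chainImage f δ S := by
  rintro _ ⟨x, hx, rfl⟩
  refine ⟨fun i => f^[i] x, 1, ⟨le_rfl, fun i _ => ?_⟩, hx, rfl⟩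
  simpa [Function.iterate_succ_apply'] using hδ

lemma closedBall_subset_chainImage {X : Type*} [MetricSpace X] {f : X → X} {δ : ℝ} {S : Set X}
    {a : X} (ha : a ∈ chainImage f δ S) : closedBall (f a) δ ⊆ chainImage f δ S := by
  obtain ⟨c, k, ⟨-, hc⟩, h0, rfl⟩ := ha
  intro y hy
  refine ⟨fun i => if i ≤ k then c i else y, k + 1, ⟨by omega, fun i hi => ?_⟩, by simpa, by simp⟩
  rcases (Nat.lt_succ_iff.mp hi).lt_or_eq with h | rfl
  · simpa [h.le, Nat.succ_le_iff.mpr h] using hc i h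
  · simpa [dist_comm] using hy

/-- The set of endpoints of `δ`-chains starting in `S` absorbs the image of its closure. -/
lemma image_closure_chainImage_subset {X : Type*} [MetricSpace X] {f : X → X} (hf : Continuous f)
    {δ : ℝ} (hδ : 0 < δ) (S : Set X) :
    f '' closure (chainImage f δ S) ⊆ interior (chainImage f δ S) := by
  rintro _ ⟨y, hy, rfl⟩
  obtain ⟨a, hay, ha⟩ := mem_closure_iff_nhds.mp hy _
    (hf.continuousAt.preimage_mem_nhds (ball_mem_nhds (f y) hδ))
  refine interior_mono (ball_subset_closedBall.trans (closedBall_subset_chainImage ha)) ?_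
  rw [isOpen_ball.interior_eq, mem_ball_comm]
  exact hay

/-- Lemma B.1: if `S` is closed with `f(S) = S` and chain stable, then for any `r > 0`
there is `A` with `S ⊆ A ⊆ B_r(S)` and `f(closure A) ⊆ interior A`. -/
theorem exists_absorbing_neighborhood {X : Type*} [MetricSpace X] [CompactSpace X]
    (f : X → X) (hf : Continuous f) {S : Set X} (hSc : IsClosed S) (hfS : f '' S = S)
    (hstable : ChainStable f S) (r : ℝ) (hr : 0 < r) :
    ∃ A : Set X, S ⊆ A ∧ A ⊆ {x : X | infDist x S ≤ r} ∧
      f '' closure A ⊆ interior A := by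
  obtain ⟨δ, hδ, h⟩ := hstable r hr
  refine ⟨chainImage f δ S, ?_, ?_, image_closure_chainImage_subset hf hδ S⟩
  · exact hfS.symm.subset.trans (image_subset_chainImage f hδ.le S)
  · rintro _ ⟨c, k, hc, h0, rfl⟩
    exact h c k hc h0
end

section
/- Let (X,d) be a compact metric space, f : X → X a continuous map with the h-shadowing property, and S a closed subset of X with f(S) = S which is chain stable. Then for every r > 0 there exists a clopen subset B of X such that S ⊆ B ⊆ B_r(S). -/
open Metric Set Function

/-- The set of endpoints of `δ`-chains starting in `S`. -/
def chainReachable {X : Type*} [MetricSpace X] (f : X → X) (δ : ℝ) (S : Set X) : Set X :=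
  {y | ∃ (c : ℕ → X) (k : ℕ), IsDeltaChain f δ c k ∧ c 0 ∈ S ∧ c k = y}

theorem mem_chainReachable_of_mem {X : Type*} [MetricSpace X] {f : X → X} {δ : ℝ} {S : Set X}
    {x y : X} (hx : x ∈ S) (hxy : dist (f x) y ≤ δ) : y ∈ chainReachable f δ S := by
  refine ⟨fun i => if i = 0 then x else y, 1, ⟨le_rfl, fun i hi => ?_⟩, by simpa, by simp⟩
  obtain rfl : i = 0 := by omega
  simpa using hxy

theorem mem_chainReachable_of_dist_le {X : Type*} [MetricSpace X] {f : X → X} {δ : ℝ} {S : Set X}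
    {x y : X} (hx : x ∈ chainReachable f δ S) (hxy : dist (f x) y ≤ δ) :
    y ∈ chainReachable f δ S := by
  obtain ⟨c, k, ⟨hk, hc⟩, h0, rfl⟩ := hx
  refine ⟨fun i => if i ≤ k then c i else y, k + 1, ⟨by omega, fun i hi => ?_⟩,
    by simpa, by simp⟩
  rcases Nat.lt_succ_iff_lt_or_eq.1 hi with h | rfl
  · simpa [h.le, Nat.succ_le_of_lt h] using hc i h
  · simpa using hxy

theorem mem_closure_chainReachable_of_dist_lt {X : Type*} [MetricSpace X] {f : X → X}
    (hf : Continuous f) {δ : ℝ} {S : Set X} {x y : X}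
    (hx : x ∈ closure (chainReachable f δ S)) (hxy : dist (f x) y < δ) :
    y ∈ closure (chainReachable f δ S) := by
  have hopen : IsOpen {z | dist (f z) y < δ} :=
    isOpen_lt (hf.dist continuous_const) continuous_const
  obtain ⟨z, hzy, hz⟩ := mem_closure_iff.1 hx _ hopen hxy
  exact subset_closure (mem_chainReachable_of_dist_le hz (le_of_lt hzy))

/-- Under h-shadowing, `⋂ n, f^[n + 1] '' K` is open whenever `K` absorbs a uniform
neighbourhood of its image. -/
theorem HShadowing.isOpen_iInter_image_iterate {X : Type*} [MetricSpace X] {f : X → X}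
    (hsh : HShadowing f) {K : Set X} {ε : ℝ} (hε : 0 < ε)
    (hK : ∀ x ∈ K, ∀ y, dist (f x) y ≤ ε → y ∈ K) :
    IsOpen (⋂ n : ℕ, f^[n + 1] '' K) := by
  obtain ⟨η, hη, hs⟩ := hsh ε hε
  refine Metric.isOpen_iff.2 fun a ha => ⟨η, hη, fun y hy => mem_iInter.2 fun n => ?_⟩
  obtain ⟨w, hw, hwa⟩ := mem_iInter.1 ha (n + 1)
  have hwa' : f (f^[n] (f w)) = a := by
    rw [← iterate_succ_apply' f n, ← iterate_succ_apply f (n + 1)]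
    exact hwa
  obtain ⟨x, hx, hxy⟩ := hs (fun i => if i ≤ n then f^[i] (f w) else y) (n + 1)
    ⟨by omega, fun i hi => by
      rcases Nat.lt_succ_iff_lt_or_eq.1 hi with h | rfl
      · simpa [h.le, Nat.succ_le_of_lt h, ← iterate_succ_apply' f] using hη.le
      · simpa [hwa', dist_comm] using (mem_ball.1 hy).le⟩
  refine ⟨x, hK w hw x ?_, by simpa using hxy⟩
  simpa [dist_comm] using hx 0 n.succ_pos

/-- Lemma B.2: if `f` has the h-shadowing property and `S` is closed with `f(S) = S` and
chain stable, then for any `r > 0` there is a clopen `B` with `S ⊆ B ⊆ B_r(S)`. -/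
theorem exists_clopen_neighborhood {X : Type*} [MetricSpace X] [CompactSpace X]
    (f : X → X) (hf : Continuous f) (hsh : HShadowing f)
    {S : Set X} (hSc : IsClosed S) (hfS : f '' S = S) (hstable : ChainStable f S)
    (r : ℝ) (hr : 0 < r) :
    ∃ B : Set X, IsClopen B ∧ S ⊆ B ∧ B ⊆ {x : X | infDist x S ≤ r} := by
  obtain ⟨δ, hδ, hstab⟩ := hstable r hr
  let K := closure (chainReachable f δ S)
  have hK : ∀ x ∈ K, ∀ y, dist (f x) y ≤ δ / 2 → y ∈ K := fun x hx y hxy =>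
    mem_closure_chainReachable_of_dist_lt hf hx (hxy.trans_lt (half_lt_self hδ))
  have hSK : S ⊆ K := fun y hy => by
    obtain ⟨x, hx, rfl⟩ := hfS.symm ▸ hy
    exact subset_closure (mem_chainReachable_of_mem hx (by simpa using hδ.le))
  have hKr : K ⊆ {x : X | infDist x S ≤ r} := by
    refine closure_minimal ?_ (isClosed_le (continuous_infDist_pt S) continuous_const)
    rintro _ ⟨c, k, hc, h0, rfl⟩
    exact hstab c k hc h0
  refine ⟨⋂ n : ℕ, f^[n + 1] '' K, ⟨?_, ?_⟩, ?_, ?_⟩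
  · exact isClosed_iInter fun n =>
      (isClosed_closure.isCompact.image (hf.iterate (n + 1))).isClosed
  · exact hsh.isOpen_iInter_image_iterate (half_pos hδ) hK
  · refine subset_iInter fun n => ?_
    have hn : f^[n + 1] '' S = S := by
      rw [image_iterate_eq]
      exact iterate_fixed hfS (n + 1)
    exact hn.symm.subset.trans (image_mono hSK)
  · intro x hx
    obtain ⟨w, hw, rfl⟩ := mem_iInter.1 hx 0
    exact hKr (hK w hw _ (by simpa using (half_pos hδ).le))
end

section
/- Let X = {0} ∪ {2^{−n} : n ≥ 0} ⊆ ℝ with the induced metric, and define f : X → X by f(1) = 1 and f(x) = 2x for x ∈ X \ {1}. Then for every x ∈ X and every 0 < δ < 1/2, the closed ball B_δ(f(x)) in X is contained in f(B_{δ/2}(x)); in particular, f is ball expanding. -/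
open Metric Set Function

/-- The space `X = {0} ∪ {2^{-n} : n ≥ 0} ⊆ ℝ`. -/
def Xdoubling : Set ℝ := {0} ∪ {x : ℝ | ∃ n : ℕ, x = (2 : ℝ)⁻¹ ^ n}

theorem Xdoubling_le_one {y : ℝ} (hy : y ∈ Xdoubling) : y ≤ 1 := by
  rcases hy with rfl | ⟨n, rfl⟩
  · exact zero_le_one
  · exact pow_le_one₀ (by norm_num) (by norm_num)

theorem Xdoubling_eq_one {y : ℝ} (hy : y ∈ Xdoubling) (h : 1 / 2 < y) : y = 1 := by
  rcases hy with rfl | ⟨_ | n, rfl⟩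
  · norm_num at h
  · simp
  · have : (2 : ℝ)⁻¹ ^ n ≤ 1 := pow_le_one₀ (by norm_num) (by norm_num)
    rw [pow_succ] at h
    linarith

theorem half_mem_Xdoubling {y : ℝ} (hy : y ∈ Xdoubling) : y / 2 ∈ Xdoubling := by
  rcases hy with rfl | ⟨n, rfl⟩
  · left
    simp
  · exact Or.inr ⟨n + 1, by rw [pow_succ, div_eq_mul_inv]⟩

/-- The map `f(1) = 1`, `f(x) = 2x` otherwise, on `X = {0} ∪ {2^{-n} : n ≥ 0}` satisfies
`B_δ(f x) ⊆ f (B_{δ/2} x)` for `0 < δ < 1/2`; in particular `f` is ball expanding. -/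
theorem example21_ballExpanding (f : Xdoubling → Xdoubling)
    (hf1 : ∀ x : Xdoubling, (x : ℝ) = 1 → (f x : ℝ) = 1)
    (hf2 : ∀ x : Xdoubling, (x : ℝ) ≠ 1 → (f x : ℝ) = 2 * (x : ℝ)) :
    (∀ (x : Xdoubling) (δ : ℝ), 0 < δ → δ < 1 / 2 →
      closedBall (f x) δ ⊆ f '' closedBall x (δ / 2)) ∧
    BallExpanding f := by
  have key : ∀ (x : Xdoubling) (δ : ℝ), 0 < δ → δ < 1 / 2 →
      closedBall (f x) δ ⊆ f '' closedBall x (δ / 2) := by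
    intro x δ hδ hδ' y hy
    rw [mem_closedBall, Subtype.dist_eq, Real.dist_eq, abs_le] at hy
    by_cases hx : (x : ℝ) = 1
    · rw [hf1 x hx] at hy
      have hy1 : (y : ℝ) = 1 := Xdoubling_eq_one y.2 (by linarith)
      exact ⟨x, mem_closedBall_self (by linarith), Subtype.ext ((hf1 x hx).trans hy1.symm)⟩
    · rw [hf2 x hx] at hy
      have hne : (y : ℝ) / 2 ≠ 1 := by
        have := Xdoubling_le_one y.2
        intro h
        linarith
      refine ⟨⟨y / 2, half_mem_Xdoubling y.2⟩, ?_, Subtype.ext ?_⟩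
      · rw [mem_closedBall, Subtype.dist_eq, Real.dist_eq, abs_le]
        constructor <;> linarith
      · rw [hf2 _ hne]
        ring
  refine ⟨key, 1 / 2, 1 / 4, by norm_num, by norm_num, by norm_num, fun x δ hδ hδ' => ?_⟩
  rw [one_div_mul_eq_div]
  exact key x δ hδ (by linarith)
end

section
/- Let I_n = [4^{−n}, 2·4^{−n}] for n ≥ 1, let X = {0, 2} ∪ ⋃_{n≥1} I_n ⊆ ℝ with the induced metric, and define f : X → X by f(x) = 2 for x ∈ {2} ∪ I_1 and f(x) = 4x for x ∈ X \ ({2} ∪ I_1). Then for every x ∈ X and every 0 < δ < 3/2, the closed ball B_δ(f(x)) in X is contained in f(B_{δ/4}(x)); in particular, f is ball expanding. -/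
open Metric Set Function

/-- The space `X = {0, 2} ∪ ⋃_{n ≥ 1} [4^{-n}, 2 · 4^{-n}] ⊆ ℝ`. -/
def Xquad : Set ℝ :=
  {0, 2} ∪ ⋃ n : ℕ, Set.Icc ((4 : ℝ)⁻¹ ^ (n + 1)) (2 * (4 : ℝ)⁻¹ ^ (n + 1))

theorem le_eighth_of_mem_Xquad {x : ℝ} (hx : x ∈ Xquad)
    (h : ¬ (x = 2 ∨ x ∈ Set.Icc ((4 : ℝ)⁻¹) (2 * (4 : ℝ)⁻¹))) : x ≤ 1 / 8 := by
  rcases hx with (rfl | rfl) | hx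
  · norm_num
  · exact absurd (Or.inl rfl) h
  · obtain ⟨n, hn⟩ := Set.mem_iUnion.1 hx
    cases n with
    | zero => exact absurd (Or.inr (by simpa using hn)) h
    | succ n =>
      have hpow : (4 : ℝ)⁻¹ ^ n ≤ 1 := pow_le_one₀ (by norm_num) (by norm_num)
      have hx2 := hn.2
      rw [pow_succ, pow_succ] at hx2
      linarith

theorem le_half_of_mem_Xquad {y : ℝ} (hy : y ∈ Xquad) (h : y ≠ 2) : y ≤ 1 / 2 := by
  by_cases hy1 : y ∈ Set.Icc ((4 : ℝ)⁻¹) (2 * (4 : ℝ)⁻¹)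
  · linarith [hy1.2]
  · linarith [le_eighth_of_mem_Xquad hy (not_or.2 ⟨h, hy1⟩)]

theorem div_four_mem_Xquad {y : ℝ} (hy : y ∈ Xquad) (h : y ≠ 2) : y / 4 ∈ Xquad := by
  rcases hy with (rfl | rfl) | hy
  · simp [Xquad]
  · exact absurd rfl h
  · obtain ⟨n, hn⟩ := Set.mem_iUnion.1 hy
    refine Or.inr (Set.mem_iUnion.2 ⟨n + 1, ?_, ?_⟩) <;> rw [pow_succ] <;> linarith [hn.1, hn.2]

/-- The map `f(x) = 2` on `{2} ∪ I₁` and `f(x) = 4x` otherwise, on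
`X = {0,2} ∪ ⋃_{n ≥ 1} I_n` with `I_n = [4^{-n}, 2·4^{-n}]`, satisfies
`B_δ(f x) ⊆ f (B_{δ/4} x)` for `0 < δ < 3/2`; in particular `f` is ball expanding. -/
theorem example22_ballExpanding (f : Xquad → Xquad)
    (hf1 : ∀ x : Xquad, ((x : ℝ) = 2 ∨ (x : ℝ) ∈ Set.Icc ((4 : ℝ)⁻¹) (2 * (4 : ℝ)⁻¹)) →
      (f x : ℝ) = 2)
    (hf2 : ∀ x : Xquad, ¬ ((x : ℝ) = 2 ∨ (x : ℝ) ∈ Set.Icc ((4 : ℝ)⁻¹) (2 * (4 : ℝ)⁻¹)) →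
      (f x : ℝ) = 4 * (x : ℝ)) :
    (∀ (x : Xquad) (δ : ℝ), 0 < δ → δ < 3 / 2 →
      closedBall (f x) δ ⊆ f '' closedBall x (δ / 4)) ∧
    BallExpanding f := by
  have key : ∀ (x : Xquad) (δ : ℝ), 0 < δ → δ < 3 / 2 →
      closedBall (f x) δ ⊆ f '' closedBall x (δ / 4) := by
    intro x δ hδ hδ' y hy
    rw [mem_closedBall, Subtype.dist_eq, Real.dist_eq] at hy
    obtain ⟨hy1, hy2⟩ := abs_le.1 hy
    by_cases hx : (x : ℝ) = 2 ∨ (x : ℝ) ∈ Set.Icc ((4 : ℝ)⁻¹) (2 * (4 : ℝ)⁻¹)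
    · have hfx := hf1 x hx
      have hy_eq : (y : ℝ) = 2 := by
        by_contra hne
        linarith [le_half_of_mem_Xquad y.2 hne]
      exact ⟨x, mem_closedBall_self (by positivity), Subtype.ext (hfx.trans hy_eq.symm)⟩
    · have hfx := hf2 x hx
      have hx_le := le_eighth_of_mem_Xquad x.2 hx
      have hne : (y : ℝ) ≠ 2 := fun h => by linarith
      have hy_le := le_half_of_mem_Xquad y.2 hne
      refine ⟨⟨y / 4, div_four_mem_Xquad y.2 hne⟩, ?_, Subtype.ext ?_⟩
      · rw [mem_closedBall, Subtype.dist_eq, Real.dist_eq, abs_le]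
        constructor <;> dsimp only <;> linarith
      · rw [hf2 _ ?_]
        · dsimp only
          ring
        · rintro (h | h)
          · dsimp only at h
            linarith
          · linarith [h.1]
  refine ⟨key, 1 / 4, 1, by norm_num, by norm_num, one_pos, fun x δ hδ hδ' => ?_⟩
  rw [one_div_mul_eq_div]
  exact key x δ hδ (by linarith)
end
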